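/- arXiv:1006.1433 — 7 statements merged into one kernel-verified Lean document; each statement's English description precedes it below -/
import Mathlib

section
/- Subject reduction: if Δ ⊢ s : A is a valid typing judgment and s → t (one step of the reduction system L), then Δ ⊢ t : A is a valid typing judgment. -/
/-!
Formalization of the computational algebraic lambda-calculus
(simply-typed, call-by-value lambda-calculus endowed with a structure of
module over a ring `R` of scalars), using de Bruijn indices
(so that α-equivalence is definitional and substitution is capture-avoiding).
-/

namespace AlgLC

/-- Simple types: base types, arrows, products, unit `⊤`, and the monadic type `M A`. -/
inductive Ty (ι : Type) : Type
  | base : ι → Ty ι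
  | arrow : Ty ι → Ty ι → Ty ι
  | prod : Ty ι → Ty ι → Ty ι
  | unit : Ty ι
  | m : Ty ι → Ty ι

/-- Terms (de Bruijn representation): variables, abstraction, application,
pairs `⟨s,t⟩`, projections `π₁ s`, `π₂ s`, the unit `∗`, sums `s+t`,
scalar multiplications `α·s`, the null term `𝟎`, closures `[s]` and
the "run" construct `¡s`. -/
inductive Term (R : Type) : Type
  | var : ℕ → Term R
  | lam : Term R → Term R
  | app : Term R → Term R → Term R
  | pair : Term R → Term R → Term R
  | fst : Term R → Term R
  | snd : Term R → Term R
  | star : Term R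
  | add : Term R → Term R → Term R
  | smul : R → Term R → Term R
  | zero : Term R
  | clos : Term R → Term R
  | unclos : Term R → Term R

variable {R : Type} {ι : Type}

/-- Shift the free de Bruijn indices `≥ k` up by `d`. -/
def lift (d : ℕ) : ℕ → Term R → Term R
  | k, .var n => .var (if n < k then n else n + d)
  | k, .lam t => .lam (lift d (k+1) t)
  | k, .app s t => .app (lift d k s) (lift d k t)
  | k, .pair s t => .pair (lift d k s) (lift d k t)
  | k, .fst s => .fst (lift d k s)
  | k, .snd s => .snd (lift d k s)
  | _, .star => .star
  | k, .add s t => .add (lift d k s) (lift d k t)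
  | k, .smul a s => .smul a (lift d k s)
  | _, .zero => .zero
  | k, .clos s => .clos (lift d k s)
  | k, .unclos s => .unclos (lift d k s)

/-- Capture-avoiding substitution `s[k := v]` of `v` for the de Bruijn index `k`. -/
def subst : Term R → ℕ → Term R → Term R
  | .var n, k, v => if n = k then v else if n < k then .var n else .var (n-1)
  | .lam t, k, v => .lam (subst t (k+1) (lift 1 0 v))
  | .app s t, k, v => .app (subst s k v) (subst t k v)
  | .pair s t, k, v => .pair (subst s k v) (subst t k v)
  | .fst s, k, v => .fst (subst s k v)
  | .snd s, k, v => .snd (subst s k v)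
  | .star, _, _ => .star
  | .add s t, k, v => .add (subst s k v) (subst t k v)
  | .smul a s, k, v => .smul a (subst s k v)
  | .zero, _, _ => .zero
  | .clos s, k, v => .clos (subst s k v)
  | .unclos s, k, v => .unclos (subst s k v)

/-- Values: `u,v ::= x | λx.u | u v | ⟨u,v⟩ | π₁ u | π₂ u | ∗ | [s]`. -/
inductive IsValue : Term R → Prop
  | var {n} : IsValue (.var n)
  | lam {u} : IsValue u → IsValue (.lam u)
  | app {u v} : IsValue u → IsValue v → IsValue (.app u v)
  | pair {u v} : IsValue u → IsValue v → IsValue (.pair u v)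
  | fst {u} : IsValue u → IsValue (.fst u)
  | snd {u} : IsValue u → IsValue (.snd u)
  | star : IsValue .star
  | clos {s} : IsValue (.clos s)

/-- Typing judgments `Δ ⊢ s : A` (the context is a list of types, de Bruijn style). -/
inductive Typed : List (Ty ι) → Term R → Ty ι → Prop
  | var {Γ : List (Ty ι)} {n A} : Γ[n]? = some A → Typed Γ (.var n) A
  | star {Γ} : Typed Γ .star .unit
  | zero {Γ A} : Typed Γ .zero A
  | lam {Γ s A B} : Typed (A :: Γ) s B → Typed Γ (.lam s) (.arrow A B)
  | app {Γ s t A B} : Typed Γ s (.arrow A B) → Typed Γ t A → Typed Γ (.app s t) B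
  | pair {Γ s t A B} : Typed Γ s A → Typed Γ t B → Typed Γ (.pair s t) (.prod A B)
  | fst {Γ s A B} : Typed Γ s (.prod A B) → Typed Γ (.fst s) A
  | snd {Γ s A B} : Typed Γ s (.prod A B) → Typed Γ (.snd s) B
  | smul {Γ s A} (a : R) : Typed Γ s A → Typed Γ (.smul a s) A
  | add {Γ s t A} : Typed Γ s A → Typed Γ t A → Typed Γ (.add s t) A
  | clos {Γ s A} : Typed Γ s A → Typed Γ (.clos s) (.m A)
  | unclos {Γ s A} : Typed Γ s (.m A) → Typed Γ (.unclos s) A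

/-- `≃_AC` : the smallest congruent equivalence relation containing
commutativity and associativity of `+`. -/
inductive AC : Term R → Term R → Prop
  | comm {s t} : AC (.add s t) (.add t s)
  | assoc {r s t} : AC (.add r (.add s t)) (.add (.add r s) t)
  | refl (s) : AC s s
  | symm {s t} : AC s t → AC t s
  | trans {s t u} : AC s t → AC t u → AC s u
  | lam {s s'} : AC s s' → AC (.lam s) (.lam s')
  | appL {s s' t} : AC s s' → AC (.app s t) (.app s' t)
  | appR {s t t'} : AC t t' → AC (.app s t) (.app s t')
  | pairL {s s' t} : AC s s' → AC (.pair s t) (.pair s' t)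
  | pairR {s t t'} : AC t t' → AC (.pair s t) (.pair s t')
  | fst {s s'} : AC s s' → AC (.fst s) (.fst s')
  | snd {s s'} : AC s s' → AC (.snd s) (.snd s')
  | addL {s s' t} : AC s s' → AC (.add s t) (.add s' t)
  | addR {s t t'} : AC t t' → AC (.add s t) (.add s t')
  | smul {a s s'} : AC s s' → AC (.smul a s) (.smul a s')
  | clos {s s'} : AC s s' → AC (.clos s) (.clos s')
  | unclos {s s'} : AC s s' → AC (.unclos s) (.unclos s')

section Rules

variable [Ring R]

/-- The rules of group E. -/
inductive RuleE : Term R → Term R → Prop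
  | smul_zero (a : R) : RuleE (.smul a .zero) .zero
  | zero_smul (s : Term R) : RuleE (.smul 0 s) .zero
  | one_smul (s : Term R) : RuleE (.smul 1 s) s
  | zero_add (s : Term R) : RuleE (.add .zero s) s
  | smul_smul (a b : R) (s : Term R) : RuleE (.smul a (.smul b s)) (.smul (a * b) s)
  | smul_add (a : R) (s t : Term R) :
      RuleE (.smul a (.add s t)) (.add (.smul a s) (.smul a t))

/-- The rules of group F. -/
inductive RuleF : Term R → Term R → Prop
  | add_smul (a b : R) (s : Term R) :
      RuleF (.add (.smul a s) (.smul b s)) (.smul (a + b) s)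
  | smul_self (a : R) (s : Term R) : RuleF (.add (.smul a s) s) (.smul (a + 1) s)
  | self_self (s : Term R) : RuleF (.add s s) (.smul (1 + 1) s)

/-- The rules of group A. -/
inductive RuleA : Term R → Term R → Prop
  | add_app (s t r : Term R) : RuleA (.app (.add s t) r) (.add (.app s r) (.app t r))
  | app_add (r s t : Term R) : RuleA (.app r (.add s t)) (.add (.app r s) (.app r t))
  | smul_app (a : R) (s r : Term R) : RuleA (.app (.smul a s) r) (.smul a (.app s r))
  | app_smul (a : R) (r s : Term R) : RuleA (.app r (.smul a s)) (.smul a (.app r s))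
  | zero_app (r : Term R) : RuleA (.app .zero r) .zero
  | app_zero (r : Term R) : RuleA (.app r .zero) .zero
  | lam_add (s t : Term R) : RuleA (.lam (.add s t)) (.add (.lam s) (.lam t))
  | lam_smul (a : R) (s : Term R) : RuleA (.lam (.smul a s)) (.smul a (.lam s))
  | lam_zero : RuleA (.lam .zero) (.zero : Term R)
  | unclos_add (s t : Term R) : RuleA (.unclos (.add s t)) (.add (.unclos s) (.unclos t))
  | unclos_smul (a : R) (s : Term R) : RuleA (.unclos (.smul a s)) (.smul a (.unclos s))
  | unclos_zero : RuleA (.unclos .zero) (.zero : Term R)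

/-- The rules of group B: call-by-value β, running a closure, projections of pairs of values. -/
inductive RuleB : Term R → Term R → Prop
  | beta {s v : Term R} : IsValue v → RuleB (.app (.lam s) v) (subst s 0 v)
  | run (s : Term R) : RuleB (.unclos (.clos s)) s
  | fst {u v : Term R} : IsValue u → IsValue v → RuleB (.fst (.pair u v)) u
  | snd {u v : Term R} : IsValue u → IsValue v → RuleB (.snd (.pair u v)) v

end Rules

/-- The smallest call-by-value congruent relation (closed under every term
construct except λ-abstraction and closures `[·]`) consistent with `≃_AC`
generated by a set `Rb` of basic rules. -/
inductive Step (Rb : Term R → Term R → Prop) : Term R → Term R → Prop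
  | base {s t} : Rb s t → Step Rb s t
  | appL {s s' t} : Step Rb s s' → Step Rb (.app s t) (.app s' t)
  | appR {s t t'} : Step Rb t t' → Step Rb (.app s t) (.app s t')
  | pairL {s s' t} : Step Rb s s' → Step Rb (.pair s t) (.pair s' t)
  | pairR {s t t'} : Step Rb t t' → Step Rb (.pair s t) (.pair s t')
  | fst {s s'} : Step Rb s s' → Step Rb (.fst s) (.fst s')
  | snd {s s'} : Step Rb s s' → Step Rb (.snd s) (.snd s')
  | addL {s s' t} : Step Rb s s' → Step Rb (.add s t) (.add s' t)
  | addR {s t t'} : Step Rb t t' → Step Rb (.add s t) (.add s t')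
  | smul {a s s'} : Step Rb s s' → Step Rb (.smul a s) (.smul a s')
  | unclos {s s'} : Step Rb s s' → Step Rb (.unclos s) (.unclos s')
  | ac {s s' t t'} : AC s s' → Step Rb s' t' → AC t' t → Step Rb s t

variable [Ring R]

/-- The one-step reduction `→` of the full system `L = E ∪ F ∪ A ∪ B`. -/
def StepL : Term R → Term R → Prop :=
  Step (fun s t => RuleE s t ∨ RuleF s t ∨ RuleA s t ∨ RuleB s t)

/-- The one-step reduction of the purely algebraic system `E ∪ F ∪ A`. -/
def StepEFA : Term R → Term R → Prop :=
  Step (fun s t => RuleE s t ∨ RuleF s t ∨ RuleA s t)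


omit [Ring R] in
/-- Weakening: inserting the types `Θ` at position `Γ.length` of the context. -/
theorem Typed.lift {Θ Γ Δ : List (Ty ι)} {s : Term R} {A : Ty ι} (h : Typed (Γ ++ Δ) s A) :
    Typed (Γ ++ (Θ ++ Δ)) (lift Θ.length Γ.length s) A := by
  induction s generalizing Γ A with
  | var n =>
    cases h with
    | var h =>
      refine .var ?_
      split_ifs with hn
      · rwa [List.getElem?_append_left hn] at h ⊢
      · rw [not_lt] at hn
        rw [List.getElem?_append_right hn] at h
        rw [List.getElem?_append_right (by omega), List.getElem?_append_right (by omega), ← h]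
        congr 1
        omega
  | lam s ih =>
    cases h with
    | lam h => exact .lam (ih (Γ := _ :: Γ) h)
  | app s t ihs iht =>
    cases h with
    | app hs ht => exact .app (ihs hs) (iht ht)
  | pair s t ihs iht =>
    cases h with
    | pair hs ht => exact .pair (ihs hs) (iht ht)
  | fst s ih =>
    cases h with
    | fst h => exact .fst (ih h)
  | snd s ih =>
    cases h with
    | snd h => exact .snd (ih h)
  | star =>
    cases h
    exact .star
  | add s t ihs iht =>
    cases h with
    | add hs ht => exact .add (ihs hs) (iht ht)
  | smul a s ih =>
    cases h with
    | smul _ h => exact .smul a (ih h)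
  | zero => exact .zero
  | clos s ih =>
    cases h with
    | clos h => exact .clos (ih h)
  | unclos s ih =>
    cases h with
    | unclos h => exact .unclos (ih h)

omit [Ring R] in
/-- Substitution lemma for the variable at position `Γ.length` of the context. -/
theorem Typed.subst {Γ Δ : List (Ty ι)} {s v : Term R} {A B : Ty ι}
    (h : Typed (Γ ++ B :: Δ) s A) (hv : Typed (Γ ++ Δ) v B) :
    Typed (Γ ++ Δ) (subst s Γ.length v) A := by
  induction s generalizing Γ A v with
  | var n =>
    cases h with
    | var h =>
      rw [AlgLC.subst]
      split_ifs with heq hlt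
      · subst heq
        obtain rfl : B = A := by simpa using h
        exact hv
      · rw [List.getElem?_append_left hlt] at h
        exact .var (by rwa [List.getElem?_append_left hlt])
      · obtain ⟨m, rfl⟩ : ∃ m, n = Γ.length + m + 1 := ⟨n - Γ.length - 1, by omega⟩
        refine .var ?_
        rw [List.getElem?_append_right (by omega)] at h ⊢
        rw [show Γ.length + m + 1 - Γ.length = m + 1 by omega, List.getElem?_cons_succ] at h
        rwa [show Γ.length + m + 1 - 1 - Γ.length = m by omega]
  | lam s ih =>
    cases h with
    | @lam _ _ C _ h => exact .lam (ih (Γ := C :: Γ) h (hv.lift (Θ := [C]) (Γ := [])))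
  | app s t ihs iht =>
    cases h with
    | app hs ht => exact .app (ihs hs hv) (iht ht hv)
  | pair s t ihs iht =>
    cases h with
    | pair hs ht => exact .pair (ihs hs hv) (iht ht hv)
  | fst s ih =>
    cases h with
    | fst h => exact .fst (ih h hv)
  | snd s ih =>
    cases h with
    | snd h => exact .snd (ih h hv)
  | star =>
    cases h
    exact .star
  | add s t ihs iht =>
    cases h with
    | add hs ht => exact .add (ihs hs hv) (iht ht hv)
  | smul a s ih =>
    cases h with
    | smul _ h => exact .smul a (ih h hv)
  | zero => exact .zero
  | clos s ih =>
    cases h with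
    | clos h => exact .clos (ih h hv)
  | unclos s ih =>
    cases h with
    | unclos h => exact .unclos (ih h hv)

omit [Ring R] in
/-- AC-equivalent terms have the same types. -/
theorem AC.typed_iff {Γ : List (Ty ι)} {s t : Term R} {A : Ty ι} (h : AC s t) :
    Typed Γ s A ↔ Typed Γ t A := by
  induction h generalizing Γ A with
  | comm =>
    constructor
    all_goals
      intro h
      cases h with
      | add hs ht => exact .add ht hs
  | assoc =>
    constructor
    · intro h
      cases h with
      | add hr h =>
        cases h with
        | add hs ht => exact .add (.add hr hs) ht
    · intro h
      cases h with
      | add h ht =>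
        cases h with
        | add hr hs => exact .add hr (.add hs ht)
  | refl => exact Iff.rfl
  | symm _ ih => exact ih.symm
  | trans _ _ ih₁ ih₂ => exact ih₁.trans ih₂
  | _ =>
    rename_i ih
    constructor
    all_goals
      intro h
      cases h
      constructor <;> first | assumption | exact ih.1 ‹_› | exact ih.2 ‹_›

omit [Ring R] in
/-- If the basic rules preserve types, so does the reduction they generate. -/
theorem Step.typed {Rb : Term R → Term R → Prop}
    (hRb : ∀ {Γ : List (Ty ι)} {s t : Term R} {A : Ty ι}, Rb s t → Typed Γ s A → Typed Γ t A)
    {Γ : List (Ty ι)} {s t : Term R} {A : Ty ι} (h : Step Rb s t) (hs : Typed Γ s A) :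
    Typed Γ t A := by
  induction h generalizing A with
  | base h => exact hRb h hs
  | ac h₁ _ h₂ ih => exact h₂.typed_iff.1 (ih (h₁.typed_iff.1 hs))
  | appL _ ih =>
    cases hs with
    | app hs ht => exact .app (ih hs) ht
  | appR _ ih =>
    cases hs with
    | app hs ht => exact .app hs (ih ht)
  | pairL _ ih =>
    cases hs with
    | pair hs ht => exact .pair (ih hs) ht
  | pairR _ ih =>
    cases hs with
    | pair hs ht => exact .pair hs (ih ht)
  | fst _ ih =>
    cases hs with
    | fst hs => exact .fst (ih hs)
  | snd _ ih =>
    cases hs with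
    | snd hs => exact .snd (ih hs)
  | addL _ ih =>
    cases hs with
    | add hs ht => exact .add (ih hs) ht
  | addR _ ih =>
    cases hs with
    | add hs ht => exact .add hs (ih ht)
  | smul _ ih =>
    cases hs with
    | smul _ hs => exact .smul _ (ih hs)
  | unclos _ ih =>
    cases hs with
    | unclos hs => exact .unclos (ih hs)

theorem RuleE.typed {Γ : List (Ty ι)} {s t : Term R} {A : Ty ι} (h : RuleE s t)
    (hs : Typed Γ s A) : Typed Γ t A := by
  cases h with
  | smul_zero | zero_smul => exact .zero
  | one_smul =>
    cases hs with
    | smul _ hs => exact hs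
  | zero_add =>
    cases hs with
    | add _ hs => exact hs
  | smul_smul =>
    cases hs with
    | smul _ hs =>
      cases hs with
      | smul _ hs => exact .smul _ hs
  | smul_add =>
    cases hs with
    | smul _ hs =>
      cases hs with
      | add hs ht => exact .add (.smul _ hs) (.smul _ ht)

theorem RuleF.typed {Γ : List (Ty ι)} {s t : Term R} {A : Ty ι} (h : RuleF s t)
    (hs : Typed Γ s A) : Typed Γ t A := by
  cases h with
  | add_smul =>
    cases hs with
    | add _ hs =>
      cases hs with
      | smul _ hs => exact .smul _ hs
  | smul_self | self_self =>
    cases hs with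
    | add _ hs => exact .smul _ hs

omit [Ring R] in
theorem RuleA.typed {Γ : List (Ty ι)} {s t : Term R} {A : Ty ι} (h : RuleA s t)
    (hs : Typed Γ s A) : Typed Γ t A := by
  cases h with
  | add_app =>
    cases hs with
    | app hs hr =>
      cases hs with
      | add hs ht => exact .add (.app hs hr) (.app ht hr)
  | app_add =>
    cases hs with
    | app hr hs =>
      cases hs with
      | add hs ht => exact .add (.app hr hs) (.app hr ht)
  | smul_app =>
    cases hs with
    | app hs hr =>
      cases hs with
      | smul _ hs => exact .smul _ (.app hs hr)
  | app_smul =>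
    cases hs with
    | app hr hs =>
      cases hs with
      | smul _ hs => exact .smul _ (.app hr hs)
  | zero_app | app_zero | unclos_zero | lam_zero => exact .zero
  | lam_add =>
    cases hs with
    | lam hs =>
      cases hs with
      | add hs ht => exact .add (.lam hs) (.lam ht)
  | lam_smul =>
    cases hs with
    | lam hs =>
      cases hs with
      | smul _ hs => exact .smul _ (.lam hs)
  | unclos_add =>
    cases hs with
    | unclos hs =>
      cases hs with
      | add hs ht => exact .add (.unclos hs) (.unclos ht)
  | unclos_smul =>
    cases hs with
    | unclos hs =>
      cases hs with
      | smul _ hs => exact .smul _ (.unclos hs)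

omit [Ring R] in
theorem RuleB.typed {Γ : List (Ty ι)} {s t : Term R} {A : Ty ι} (h : RuleB s t)
    (hs : Typed Γ s A) : Typed Γ t A := by
  cases h with
  | beta =>
    cases hs with
    | app hs hv =>
      cases hs with
      | lam hs => exact hs.subst (Γ := []) hv
  | run =>
    cases hs with
    | unclos hs =>
      cases hs with
      | clos hs => exact hs
  | fst =>
    cases hs with
    | fst hs =>
      cases hs with
      | pair hu _ => exact hu
  | snd =>
    cases hs with
    | snd hs =>
      cases hs with
      | pair _ hv => exact hv

/-- **Subject reduction** : typing is preserved by one step of the reduction `L`. -/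
theorem subject_reduction {Γ : List (Ty ι)} {s t : Term R} {A : Ty ι}
    (hs : Typed Γ s A) (hst : StepL s t) : Typed Γ t A := by
  refine Step.typed (fun h hs => ?_) hst hs
  rcases h with h | h | h | h
  exacts [h.typed hs, h.typed hs, h.typed hs, h.typed hs]

end AlgLC
end

section
/- Termination of the algebraic fragment: for every term s (typed or not) there exists a natural number n_s such that every rewrite sequence starting from s and using only reduction steps from groups E, F and A has at most n_s elements; in particular the reduction relation E ∪ F ∪ A is strongly normalizing on all terms. -/
/-!
Formalization of the computational algebraic lambda-calculus
(simply-typed, call-by-value lambda-calculus endowed with a structure of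
module over a ring `R` of scalars), using de Bruijn indices
(so that α-equivalence is definitional and substitution is capture-avoiding).
-/

namespace AlgLC

variable {R : Type} {ι : Type}

variable [Ring R]

/-- A natural-number weight of terms, invariant under `≃_AC` and strictly decreasing along
the rules of groups `E`, `F` and `A`. -/
def weight : Term R → ℕ
  | .var _ => 0
  | .lam s => 3 * weight s + 1
  | .app s t => (3 * weight s + 1) * (3 * weight t + 1)
  | .pair s t => weight s + weight t
  | .fst s => weight s
  | .snd s => weight s
  | .star => 0
  | .add s t => weight s + weight t + 2
  | .smul _ s => 2 * weight s + 1
  | .zero => 0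
  | .clos _ => 0
  | .unclos s => 3 * weight s + 1

theorem AC.weight_eq {K : Type} {s t : Term K} (h : AC s t) : weight s = weight t := by
  induction h <;> grind [weight]

theorem RuleE.weight_lt {s t : Term R} (h : RuleE s t) : weight t < weight s := by
  cases h <;> simp only [weight] <;> omega

theorem RuleF.weight_lt {s t : Term R} (h : RuleF s t) : weight t < weight s := by
  cases h <;> simp only [weight] <;> omega

theorem RuleA.weight_lt {K : Type} {s t : Term K} (h : RuleA s t) : weight t < weight s := by
  cases h <;> simp only [weight] <;> first | omega | nlinarith

theorem Step.weight_lt {K : Type} {Rb : Term K → Term K → Prop}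
    (hRb : ∀ {s t}, Rb s t → weight t < weight s) {s t : Term K} (h : Step Rb s t) :
    weight t < weight s := by
  induction h with
  | base h => exact hRb h
  | ac h₁ _ h₂ ih => rwa [h₁.weight_eq, ← h₂.weight_eq]
  | _ => simp only [weight]; first | omega | nlinarith

theorem StepEFA.weight_lt {s t : Term R} (h : StepEFA s t) : weight t < weight s :=
  Step.weight_lt (by rintro s t (h | h | h) <;> exact h.weight_lt) h

theorem length_le_weight_of_isChain (l : List (Term R)) :
    ∀ s : Term R, (s :: l).IsChain StepEFA → l.length ≤ weight s := by
  induction l with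
  | nil => simp
  | cons t l ih =>
    intro s h
    rw [List.isChain_cons_cons] at h
    have := ih t h.2
    have := h.1.weight_lt
    simp only [List.length_cons]
    omega

/-- **Termination of the algebraic fragment** : every rewrite sequence using
only the rules of the groups `E`, `F`, `A` (formalized as lists of terms whose
consecutive elements are related by `StepEFA`) starting from a term `s` has at
most `n_s` elements; in particular `E ∪ F ∪ A` is strongly normalizing on all
terms. -/
theorem efa_terminating :
    (∀ s : Term R, ∃ n : ℕ, ∀ l : List (Term R),
      l.head? = some s → l.Chain' StepEFA → l.length ≤ n) ∧
    (∀ s : Term R, Acc (fun t s : Term R => StepEFA s t) s) := by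
  refine ⟨fun s => ⟨weight s + 1, fun l hs hl => ?_⟩, fun s => ?_⟩
  · cases l with
    | nil => simp
    | cons t l =>
      obtain rfl : t = s := by simpa using hs
      simpa using length_le_weight_of_isChain l t hl
  · exact Subrelation.wf (fun h => h.weight_lt) (measure weight).wf |>.apply s

end AlgLC
end

section
/- Strong normalization: if ⊢ s : A is a valid typing judgment, then there exists a natural number n_s such that every rewrite sequence (s_i) under the full reduction L with s_0 = s is finite and has at most n_s elements. -/
/-!
Formalization of the computational algebraic lambda-calculus
(simply-typed, call-by-value lambda-calculus endowed with a structure of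
module over a ring `R` of scalars), using de Bruijn indices
(so that α-equivalence is definitional and substitution is capture-avoiding).
-/

namespace AlgLC

variable {R : Type} {ι : Type}

variable [Ring R]

/-! ### Ordered monoids of denotations -/

/-- A partially ordered commutative monoid whose least element is `0`. -/
structure Dom where
  carrier : Type
  [addCommMonoid : AddCommMonoid carrier]
  [partialOrder : PartialOrder carrier]
  [isOrderedAddMonoid : IsOrderedAddMonoid carrier]
  zero_le : ∀ x : carrier, 0 ≤ x

namespace Dom

attribute [instance] addCommMonoid partialOrder isOrderedAddMonoid

/-- Denotations of terms: a size together with an element of the domain. -/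
abbrev Sized (D : Dom) : Type := ℕ × D.carrier

theorem Sized.zero_le {D : Dom} (x : D.Sized) : 0 ≤ x :=
  ⟨Nat.zero_le _, D.zero_le _⟩

/-- The one-element domain. -/
def trivial : Dom where
  carrier := PUnit
  zero_le _ := le_rfl

/-- Pairs of denotations. -/
def prod (D E : Dom) : Dom where
  carrier := D.Sized × E.Sized
  zero_le _ := Prod.mk_le_mk.2 ⟨Sized.zero_le _, Sized.zero_le _⟩

/-- Monotone functions between denotations, ordered pointwise. -/
def arrow (D E : Dom) : Dom where
  carrier := ({ carrier := {f | Monotone f}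
                zero_mem' := monotone_const
                add_mem' := Monotone.add } : AddSubmonoid (D.Sized → E.Sized))
  zero_le f := fun x => Sized.zero_le (f.1 x)

/-- Denotations seen as the elements of a domain. -/
def sized (D : Dom) : Dom where
  carrier := D.Sized
  zero_le := Sized.zero_le

/-- Strict comparison: the size decreases and the other component does not increase. -/
def Sized.Below {D : Dom} (x y : D.Sized) : Prop := x.1 < y.1 ∧ x.2 ≤ y.2

variable {D E : Dom}

namespace Sized

theorem Below.le {x y : D.Sized} (h : x.Below y) : x ≤ y := ⟨h.1.le, h.2⟩

/-- Sum of two denotations, with the size increased by `c`. -/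
def comb (c : ℕ) (x y : D.Sized) : D.Sized := (x.1 + y.1 + c, x.2 + y.2)

/-- Denotation of an application. -/
def app (f : (D.arrow E).Sized) (x : D.Sized) : E.Sized :=
  ((3 * f.1 + 2) * (3 * x.1 + 2) + (x.1 + 1) * (f.2.1 x).1, (x.1 + 1) • (f.2.1 x).2)

/-- Denotation of an abstraction. -/
def lam (g : D.Sized → E.Sized) (hg : Monotone g) : (D.arrow E).Sized :=
  (3 * (g 0).1 + 1, ⟨g, hg⟩)

/-- Denotation of a pair. -/
def pair (x : D.Sized) (y : E.Sized) : (D.prod E).Sized := (x.1 + y.1 + 1, (x, y))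

/-- Denotation of a first projection. -/
def fst (x : (D.prod E).Sized) : D.Sized := (x.1 + 1 + x.2.1.1, x.2.1.2)

/-- Denotation of a second projection. -/
def snd (x : (D.prod E).Sized) : E.Sized := (x.1 + 1 + x.2.2.1, x.2.2.2)

/-- Denotation of a closure. -/
def clos (x : D.Sized) : D.sized.Sized := (0, x)

/-- Denotation of a running closure. -/
def unclos (x : D.sized.Sized) : D.Sized := (3 * x.1 + 1 + x.2.1, x.2.2)

theorem lam_congr {g g' : D.Sized → E.Sized} {hg : Monotone g} {hg' : Monotone g'}
    (h : ∀ x, g x = g' x) : lam g hg = lam g' hg' := by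
  obtain rfl : g = g' := funext h
  rfl

/-! #### Monotonicity -/

theorem comb_mono (c : ℕ) {x x' y y' : D.Sized} (hx : x ≤ x') (hy : y ≤ y') :
    comb c x y ≤ comb c x' y' :=
  ⟨Nat.add_le_add_right (Nat.add_le_add hx.1 hy.1) c, add_le_add hx.2 hy.2⟩

theorem arrow_apply_le {f f' : (D.arrow E).Sized} {x x' : D.Sized} (hf : f.2 ≤ f'.2)
    (hx : x ≤ x') : f.2.1 x ≤ f'.2.1 x' :=
  (f.2.2 hx).trans (hf x')

theorem nsmul_le_nsmul_of_le {m n : ℕ} {x y : D.carrier} (hmn : m ≤ n) (hxy : x ≤ y) :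
    m • x ≤ n • y :=
  (nsmul_le_nsmul_right hxy m).trans (nsmul_le_nsmul_left (D.zero_le y) hmn)

theorem app_mono {f f' : (D.arrow E).Sized} {x x' : D.Sized} (hf : f ≤ f') (hx : x ≤ x') :
    app f x ≤ app f' x' := by
  have h := arrow_apply_le hf.2 hx
  have hf1 := hf.1
  have hx1 := hx.1
  have h1 := h.1
  refine ⟨?_, nsmul_le_nsmul_of_le (Nat.succ_le_succ hx.1) h.2⟩
  simp only [app]
  gcongr

theorem lam_mono {g g' : D.Sized → E.Sized} {hg : Monotone g} {hg' : Monotone g'}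
    (h : ∀ x, g x ≤ g' x) : lam g hg ≤ lam g' hg' :=
  ⟨Nat.succ_le_succ (Nat.mul_le_mul_left 3 (h 0).1), h⟩

theorem pair_mono {x x' : D.Sized} {y y' : E.Sized} (hx : x ≤ x') (hy : y ≤ y') :
    pair x y ≤ pair x' y' :=
  ⟨Nat.succ_le_succ (Nat.add_le_add hx.1 hy.1), hx, hy⟩

theorem fst_mono {x x' : (D.prod E).Sized} (h : x ≤ x') : fst x ≤ fst x' :=
  ⟨Nat.add_le_add (Nat.succ_le_succ h.1) h.2.1.1, h.2.1.2⟩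

theorem snd_mono {x x' : (D.prod E).Sized} (h : x ≤ x') : snd x ≤ snd x' :=
  ⟨Nat.add_le_add (Nat.succ_le_succ h.1) h.2.2.1, h.2.2.2⟩

theorem clos_mono {x x' : D.Sized} (h : x ≤ x') : clos x ≤ clos x' := ⟨le_rfl, h⟩

theorem unclos_mono {x x' : D.sized.Sized} (h : x ≤ x') : unclos x ≤ unclos x' :=
  ⟨Nat.add_le_add (Nat.succ_le_succ (Nat.mul_le_mul_left 3 h.1)) h.2.1, h.2.2⟩

/-! #### Strict monotonicity -/

theorem Below.comb_left {c : ℕ} {x x' y : D.Sized} (h : x.Below x') :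
    (comb c x y).Below (comb c x' y) :=
  ⟨by have := h.1; simp only [comb]; lia, add_le_add_left h.2 _⟩

theorem Below.comb_right {c : ℕ} {x y y' : D.Sized} (h : y.Below y') :
    (comb c x y).Below (comb c x y') :=
  ⟨by have := h.1; simp only [comb]; lia, add_le_add_right h.2 _⟩

theorem Below.comb {c : ℕ} {x x' y y' : D.Sized} (hx : x.Below x') (hy : y.Below y') :
    (comb c x y).Below (comb c x' y') :=
  ⟨by have := hx.1; have := hy.1; simp only [Sized.comb]; lia, add_le_add hx.2 hy.2⟩

theorem Below.app_left {f f' : (D.arrow E).Sized} {x : D.Sized} (h : f.Below f') :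
    (app f x).Below (app f' x) := by
  refine ⟨?_, (app_mono h.le le_rfl).2⟩
  have h1 := h.1
  have h2 := (arrow_apply_le h.2 (le_refl x)).1
  simp only [app]
  refine add_lt_add_of_lt_of_le ?_ (Nat.mul_le_mul_left _ h2)
  gcongr

theorem Below.app_right {f : (D.arrow E).Sized} {x x' : D.Sized} (h : x.Below x') :
    (app f x).Below (app f x') := by
  refine ⟨?_, (app_mono le_rfl h.le).2⟩
  have h1 := h.1
  have h2 := (arrow_apply_le (le_refl f.2) h.le).1
  simp only [app]
  refine add_lt_add_of_lt_of_le ?_ (Nat.mul_le_mul (Nat.succ_le_succ h1.le) h2)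
  gcongr

theorem Below.pair_left {x x' : D.Sized} {y : E.Sized} (h : x.Below x') :
    (pair x y).Below (pair x' y) :=
  ⟨by have := h.1; simp only [pair]; lia, h.le, le_rfl⟩

theorem Below.pair_right {x : D.Sized} {y y' : E.Sized} (h : y.Below y') :
    (pair x y).Below (pair x y') :=
  ⟨by have := h.1; simp only [pair]; lia, le_rfl, h.le⟩

theorem Below.fst {x x' : (D.prod E).Sized} (h : x.Below x') : (fst x).Below (fst x') :=
  ⟨Nat.add_lt_add_of_lt_of_le (Nat.succ_lt_succ h.1) h.2.1.1, h.2.1.2⟩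

theorem Below.snd {x x' : (D.prod E).Sized} (h : x.Below x') : (snd x).Below (snd x') :=
  ⟨Nat.add_lt_add_of_lt_of_le (Nat.succ_lt_succ h.1) h.2.2.1, h.2.2.2⟩

theorem Below.unclos {x x' : D.sized.Sized} (h : x.Below x') : (unclos x).Below (unclos x') :=
  ⟨Nat.add_lt_add_of_lt_of_le (by have := h.1; lia) h.2.1, h.2.2⟩

/-! #### Sums -/

theorem comb_comm (c : ℕ) (x y : D.Sized) : comb c x y = comb c y x := by
  simp only [comb, add_comm]

theorem comb_assoc (c : ℕ) (x y z : D.Sized) :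
    comb c x (comb c y z) = comb c (comb c x y) z :=
  Prod.ext (by simp only [comb]; lia) (add_assoc _ _ _).symm

theorem below_comb_left {c : ℕ} (hc : 0 < c) (x y : D.Sized) : x.Below (comb c x y) :=
  ⟨by simp only [comb]; lia, le_add_of_nonneg_right (D.zero_le _)⟩

theorem below_comb_right {c : ℕ} (hc : 0 < c) (x y : D.Sized) : y.Below (comb c x y) :=
  comb_comm c y x ▸ below_comb_left hc y x

theorem zero_below {x : D.Sized} (h : 0 < x.1) : (0 : D.Sized).Below x := ⟨h, D.zero_le _⟩

theorem comb_below_comb {c d : ℕ} (h : c < d) (x y : D.Sized) :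
    (comb c x y).Below (comb d x y) :=
  ⟨Nat.add_lt_add_left h _, le_rfl⟩

theorem comb_comb_below (x x' y y' : D.Sized) :
    (comb 2 (comb 1 x x') (comb 1 y y')).Below (comb 1 (comb 2 x y) (comb 2 x' y')) :=
  ⟨by simp only [comb]; lia, (add_add_add_comm _ _ _ _).le⟩

/-! #### Distributivity -/

theorem comb_app_below {c : ℕ} (hc : 0 < c) (f g : (D.arrow E).Sized) (x : D.Sized) :
    (comb c (app f x) (app g x)).Below (app (comb c f g) x) := by
  refine ⟨?_, (nsmul_add _ _ _).ge⟩
  change _ < (3 * (f.1 + g.1 + c) + 2) * (3 * x.1 + 2) +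
    (x.1 + 1) * ((f.2.1 x).1 + (g.2.1 x).1)
  simp only [comb, app]
  nlinarith [Nat.zero_le (c * x.1), Nat.mul_le_mul_right x.1 hc]

theorem comb_app_below' {c : ℕ} (hc : 0 < c) (f : (D.arrow E).Sized) (x y : D.Sized) :
    (comb c (app f x) (app f y)).Below (app f (comb c x y)) := by
  have hx := f.2.2 (below_comb_left hc x y).le
  have hy := f.2.2 (below_comb_right hc x y).le
  constructor
  · have h₁ := Nat.mul_le_mul_left (x.1 + 1) hx.1
    have h₂ := Nat.mul_le_mul_left (y.1 + 1) hy.1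
    have h₃ : (x.1 + 1 + (y.1 + 1)) * (f.2.1 (comb c x y)).1 ≤
        (x.1 + y.1 + c + 1) * (f.2.1 (comb c x y)).1 := Nat.mul_le_mul_right _ (by lia)
    change _ < (3 * f.1 + 2) * (3 * (x.1 + y.1 + c) + 2) +
      (x.1 + y.1 + c + 1) * (f.2.1 (comb c x y)).1
    change (3 * f.1 + 2) * (3 * x.1 + 2) + (x.1 + 1) * (f.2.1 x).1 +
      ((3 * f.1 + 2) * (3 * y.1 + 2) + (y.1 + 1) * (f.2.1 y).1) + c < _
    nlinarith [Nat.mul_le_mul_right f.1 hc]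
  · refine (add_le_add (nsmul_le_nsmul_right hx.2 _) (nsmul_le_nsmul_right hy.2 _)).trans ?_
    rw [← add_nsmul]
    exact nsmul_le_nsmul_left (E.zero_le _) (by simp only [comb]; lia)

theorem comb_lam_below {c : ℕ} (hc : 0 < c) {g g' : D.Sized → E.Sized} {hg : Monotone g}
    {hg' : Monotone g'} (h : Monotone fun x => comb c (g x) (g' x)) :
    (comb c (lam g hg) (lam g' hg')).Below (lam (fun x => comb c (g x) (g' x)) h) :=
  ⟨by simp only [comb, lam]; lia, fun _ => ⟨Nat.le_add_right _ _, le_rfl⟩⟩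

theorem comb_unclos_below {c : ℕ} (hc : 0 < c) (x y : D.sized.Sized) :
    (comb c (unclos x) (unclos y)).Below (unclos (comb c x y)) := by
  refine ⟨?_, le_rfl⟩
  change _ < 3 * (x.1 + y.1 + c) + 1 + (x.2.1 + y.2.1)
  simp only [comb, unclos]
  lia

theorem app_size_pos (f : (D.arrow E).Sized) (x : D.Sized) : 0 < (app f x).1 := by
  simp only [app]
  positivity

/-! #### Computation -/

theorem below_app_lam (g : D.Sized → E.Sized) (hg : Monotone g) (x : D.Sized) :
    (g x).Below (app (lam g hg) x) := by
  constructor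
  · simp only [app, lam]
    nlinarith [Nat.zero_le (x.1 * (g x).1), Nat.zero_le ((g 0).1 * x.1)]
  · change (g x).2 ≤ (x.1 + 1) • (g x).2
    rw [succ_nsmul]
    exact le_add_of_nonneg_left (nsmul_nonneg (E.zero_le _) _)

theorem below_unclos_clos (x : D.Sized) : x.Below (unclos (clos x)) :=
  ⟨by simp only [unclos, clos]; lia, le_rfl⟩

theorem below_fst_pair (x : D.Sized) (y : E.Sized) : x.Below (fst (pair x y)) :=
  ⟨by simp only [fst, pair]; lia, le_rfl⟩

theorem below_snd_pair (x : D.Sized) (y : E.Sized) : y.Below (snd (pair x y)) :=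
  ⟨by simp only [snd, pair]; lia, le_rfl⟩

end Sized

end Dom

/-! ### Interpretation of types and terms -/

open Dom Dom.Sized

/-- Interpretation of types. -/
def Ty.dom : Ty ι → Dom
  | .base _ => .trivial
  | .arrow A B => A.dom.arrow B.dom
  | .prod A B => A.dom.prod B.dom
  | .unit => .trivial
  | .m A => A.dom.sized

/-- Denotations of the terms of type `A`. -/
abbrev Ty.Den (A : Ty ι) : Type := A.dom.Sized

/-- Environments: a denotation of each type for each variable. -/
abbrev Env (ι : Type) : Type := ℕ → ∀ A : Ty ι, A.Den

open Classical in
/-- Environment entry with value `x` at type `A`. -/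
noncomputable def entry {A : Ty ι} (x : A.Den) : ∀ B : Ty ι, B.Den := Function.update 0 A x

/-- Extension of an environment with a value for the variable `0`. -/
noncomputable def Env.cons {A : Ty ι} (x : A.Den) (ρ : Env ι) : Env ι
  | 0 => entry x
  | n + 1 => ρ n

open Classical in
theorem entry_self {A : Ty ι} (x : A.Den) : entry x A = x := Function.update_self ..

theorem Env.cons_mono {A : Ty ι} {x y : A.Den} {ρ ρ' : Env ι} (hx : x ≤ y) (hρ : ρ ≤ ρ') :
    Env.cons x ρ ≤ Env.cons y ρ'
  | 0 => by
    classical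
    exact Function.update_mono hx
  | n + 1 => hρ n

section Interpretation

variable {K : Type}

/-- `Interp Γ s A f` : the term `s` of type `A` in the context `Γ` may be interpreted by `f`.
A term has one interpretation for each choice of the types of its subterms; the two copies
of `s` counted by `α·s` may be interpreted differently, so that they match those of `s+s`. -/
inductive Interp : List (Ty ι) → Term K → ∀ A : Ty ι, (Env ι → A.Den) → Prop
  | var {Γ : List (Ty ι)} {n A} : Γ[n]? = some A → Interp Γ (.var n) A fun ρ => ρ n A
  | star {Γ} : Interp Γ .star .unit fun _ => 0
  | zero {Γ A} : Interp Γ .zero A fun _ => 0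
  | lam {Γ s} {A B : Ty ι} {f : Env ι → B.Den} (hf : Monotone f) : Interp (A :: Γ) s B f →
      Interp Γ (.lam s) (.arrow A B) fun ρ =>
        Sized.lam (D := A.dom) (fun x => f (Env.cons x ρ))
          fun _ _ h => hf (Env.cons_mono h le_rfl)
  | app {Γ s t} {A B : Ty ι} {f : Env ι → (Ty.arrow A B).Den} {g : Env ι → A.Den} :
      Interp Γ s (.arrow A B) f → Interp Γ t A g →
      Interp Γ (.app s t) B fun ρ => Sized.app (D := A.dom) (f ρ) (g ρ)
  | pair {Γ s t} {A B : Ty ι} {f : Env ι → A.Den} {g : Env ι → B.Den} :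
      Interp Γ s A f → Interp Γ t B g →
      Interp Γ (.pair s t) (.prod A B) fun ρ => Sized.pair (f ρ) (g ρ)
  | fst {Γ s} {A B : Ty ι} {f : Env ι → (Ty.prod A B).Den} : Interp Γ s (.prod A B) f →
      Interp Γ (.fst s) A fun ρ => Sized.fst (E := B.dom) (f ρ)
  | snd {Γ s} {A B : Ty ι} {f : Env ι → (Ty.prod A B).Den} : Interp Γ s (.prod A B) f →
      Interp Γ (.snd s) B fun ρ => Sized.snd (D := A.dom) (f ρ)
  | smul {Γ s} {A : Ty ι} {f g : Env ι → A.Den} (a : K) : Interp Γ s A f → Interp Γ s A g →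
      Interp Γ (.smul a s) A fun ρ => comb 1 (f ρ) (g ρ)
  | add {Γ s t} {A : Ty ι} {f g : Env ι → A.Den} : Interp Γ s A f → Interp Γ t A g →
      Interp Γ (.add s t) A fun ρ => comb 2 (f ρ) (g ρ)
  | clos {Γ s} {A : Ty ι} {f : Env ι → A.Den} : Interp Γ s A f →
      Interp Γ (.clos s) (.m A) fun ρ => Sized.clos (f ρ)
  | unclos {Γ s} {A : Ty ι} {f : Env ι → (Ty.m A).Den} : Interp Γ s (.m A) f →
      Interp Γ (.unclos s) A fun ρ => Sized.unclos (D := A.dom) (f ρ)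

variable {Γ Δ : List (Ty ι)} {s t v : Term K} {A B : Ty ι}

theorem Interp.congr {f g : Env ι → A.Den} (h : Interp Γ s A f) (hfg : ∀ ρ, f ρ = g ρ) :
    Interp Γ s A g :=
  funext hfg ▸ h

theorem Interp.monotone {f : Env ι → A.Den} (h : Interp Γ s A f) : Monotone f := by
  induction h with
  | var => exact fun _ _ h => h _ _
  | star | zero => exact monotone_const
  | lam hf => exact fun _ _ h => lam_mono fun _ => hf (Env.cons_mono le_rfl h)
  | app _ _ ihs iht => exact fun _ _ h => app_mono (ihs h) (iht h)
  | pair _ _ ihs iht => exact fun _ _ h => pair_mono (ihs h) (iht h)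
  | fst _ ih => exact fun _ _ h => fst_mono (ih h)
  | snd _ ih => exact fun _ _ h => snd_mono (ih h)
  | smul _ _ _ ihs iht | add _ _ ihs iht => exact fun _ _ h => comb_mono _ (ihs h) (iht h)
  | clos _ ih => exact fun _ _ h => clos_mono (ih h)
  | unclos _ ih => exact fun _ _ h => unclos_mono (ih h)

theorem Typed.exists_interp (h : Typed Γ s A) : ∃ f, Interp Γ s A f := by
  induction h with
  | var h => exact ⟨_, .var h⟩
  | star => exact ⟨_, .star⟩
  | zero => exact ⟨_, .zero⟩
  | lam _ ih => exact ih.elim fun _ hf => ⟨_, .lam hf.monotone hf⟩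
  | app _ _ ihs iht => exact ihs.elim fun _ hf => iht.elim fun _ hg => ⟨_, .app hf hg⟩
  | pair _ _ ihs iht => exact ihs.elim fun _ hf => iht.elim fun _ hg => ⟨_, .pair hf hg⟩
  | fst _ ih => exact ih.elim fun _ hf => ⟨_, .fst hf⟩
  | snd _ ih => exact ih.elim fun _ hf => ⟨_, .snd hf⟩
  | smul a _ ih => exact ih.elim fun _ hf => ⟨_, .smul _ hf hf⟩
  | add _ _ ihs iht => exact ihs.elim fun _ hf => iht.elim fun _ hg => ⟨_, .add hf hg⟩
  | clos _ ih => exact ih.elim fun _ hf => ⟨_, .clos hf⟩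
  | unclos _ ih => exact ih.elim fun _ hf => ⟨_, .unclos hf⟩

/-! ### Substitution -/

/-- The renaming of variables performed by `lift d k`. -/
def liftVar (d k n : ℕ) : ℕ := if n < k then n else n + d

theorem Env.cons_liftVar (x : A.Den) (ρ : Env ι) (d k : ℕ) :
    (fun n => Env.cons x ρ (liftVar d (k + 1) n)) = Env.cons x fun n => ρ (liftVar d k n) := by
  funext n
  cases n with
  | zero => rfl
  | succ n =>
    have h : liftVar d (k + 1) (n + 1) = liftVar d k n + 1 := by
      simp only [liftVar]; split_ifs <;> lia
    rw [h]
    rfl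

theorem Interp.lift {f : Env ι → A.Den} (h : Interp Γ s A f) (d : ℕ) :
    ∀ {k : ℕ} {Δ : List (Ty ι)}, (∀ n B, Γ[n]? = some B → Δ[liftVar d k n]? = some B) →
      Interp Δ (AlgLC.lift d k s) A fun ρ => f fun n => ρ (liftVar d k n) := by
  induction h with
  | var h => exact fun hΔ => .var (hΔ _ _ h)
  | star => exact fun _ => .star
  | zero => exact fun _ => .zero
  | @lam Γ s A B f hf _ ih =>
    intro k Δ hΔ
    have ih := @ih (k + 1) (A :: Δ) fun n C hC => by
      cases n with
      | zero => exact hC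
      | succ n =>
        have h : liftVar d (k + 1) (n + 1) = liftVar d k n + 1 := by
          simp only [liftVar]; split_ifs <;> lia
        rw [h]
        exact hΔ n C hC
    exact (Interp.lam ih.monotone ih).congr fun ρ => lam_congr fun x =>
      congrArg f (Env.cons_liftVar x ρ d k)
  | app _ _ ihs iht => exact fun hΔ => .app (ihs hΔ) (iht hΔ)
  | pair _ _ ihs iht => exact fun hΔ => .pair (ihs hΔ) (iht hΔ)
  | fst _ ih => exact fun hΔ => .fst (ih hΔ)
  | snd _ ih => exact fun hΔ => .snd (ih hΔ)
  | smul a _ _ ihs iht => exact fun hΔ => .smul a (ihs hΔ) (iht hΔ)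
  | add _ _ ihs iht => exact fun hΔ => .add (ihs hΔ) (iht hΔ)
  | clos _ ih => exact fun hΔ => .clos (ih hΔ)
  | unclos _ ih => exact fun hΔ => .unclos (ih hΔ)

/-- Insertion of a value at position `k` in an environment. -/
noncomputable def Env.insert (k : ℕ) (x : A.Den) (ρ : Env ι) : Env ι := fun n =>
  if n = k then entry x else if n < k then ρ n else ρ (n - 1)

theorem Env.insert_zero (x : A.Den) (ρ : Env ι) : Env.insert 0 x ρ = Env.cons x ρ := by
  funext n
  cases n <;> simp [Env.insert, Env.cons]

theorem Env.insert_cons (k : ℕ) (x : A.Den) (y : B.Den) (ρ : Env ι) :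
    Env.insert (k + 1) x (Env.cons y ρ) = Env.cons y (Env.insert k x ρ) := by
  funext n
  rcases n with _ | _ | n
  · simp [Env.insert, Env.cons]
  · rcases k with _ | k <;> simp [Env.insert, Env.cons]
  · simp [Env.insert, Env.cons]

theorem Interp.subst {f : Env ι → B.Den} (h : Interp Γ s B f) :
    ∀ {k : ℕ} {Δ : List (Ty ι)} {v : Term K} {g : Env ι → A.Den}, Γ[k]? = some A →
      (∀ n C, n < k → Γ[n]? = some C → Δ[n]? = some C) →
      (∀ n C, k ≤ n → Γ[n + 1]? = some C → Δ[n]? = some C) → Interp Δ v A g →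
      Interp Δ (AlgLC.subst s k v) B fun ρ => f (Env.insert k (g ρ) ρ) := by
  induction h with
  | @var Γ n B h =>
    intro k Δ v g hk hlt hge hv
    simp only [AlgLC.subst, Env.insert]
    rcases lt_trichotomy n k with hn | rfl | hn
    · simp only [hn.ne, hn, if_true, if_false]
      exact .var (hlt _ _ hn h)
    · obtain rfl : A = B := Option.some.inj (hk.symm.trans h)
      simpa only [if_true, entry_self] using hv
    · obtain ⟨n, rfl⟩ := Nat.exists_eq_add_one_of_ne_zero (Nat.ne_zero_of_lt hn)
      simp only [hn.ne', hn.not_gt, if_false, Nat.add_sub_cancel]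
      exact .var (hge _ _ (Nat.le_of_lt_succ hn) h)
  | star => exact fun _ _ _ _ => .star
  | zero => exact fun _ _ _ _ => .zero
  | @lam Γ s C B f hf _ ih =>
    intro k Δ v g hk hlt hge hv
    have ih := @ih (k + 1) (C :: Δ) _ _ hk
      (fun n D hn hD => by
        cases n with
        | zero => exact hD
        | succ n => exact hlt n D (Nat.lt_of_succ_lt_succ hn) hD)
      (fun n D hn hD => by
        cases n with
        | zero => exact absurd hn (Nat.not_succ_le_zero k)
        | succ n => exact hge n D (Nat.le_of_succ_le_succ hn) hD)
      (hv.lift 1 (k := 0) fun n D hD => hD)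
    exact (Interp.lam ih.monotone ih).congr fun ρ => lam_congr fun x =>
      congrArg f (Env.insert_cons k (g ρ) x ρ)
  | app _ _ ihs iht => exact fun hk hl hg hv => .app (ihs hk hl hg hv) (iht hk hl hg hv)
  | pair _ _ ihs iht => exact fun hk hl hg hv => .pair (ihs hk hl hg hv) (iht hk hl hg hv)
  | fst _ ih => exact fun hk hl hg hv => .fst (ih hk hl hg hv)
  | snd _ ih => exact fun hk hl hg hv => .snd (ih hk hl hg hv)
  | smul a _ _ ihs iht => exact fun hk hl hg hv => .smul a (ihs hk hl hg hv) (iht hk hl hg hv)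
  | add _ _ ihs iht => exact fun hk hl hg hv => .add (ihs hk hl hg hv) (iht hk hl hg hv)
  | clos _ ih => exact fun hk hl hg hv => .clos (ih hk hl hg hv)
  | unclos _ ih => exact fun hk hl hg hv => .unclos (ih hk hl hg hv)

theorem Interp.subst_zero {f : Env ι → B.Den} {g : Env ι → A.Den}
    (hs : Interp (A :: Γ) s B f) (hv : Interp Γ v A g) :
    Interp Γ (AlgLC.subst s 0 v) B fun ρ => f (Env.cons (g ρ) ρ) :=
  (hs.subst rfl (fun _ _ hn => absurd hn (Nat.not_lt_zero _)) (fun _ _ _ h => h) hv).congr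
    fun ρ => congrArg f (Env.insert_zero (g ρ) ρ)

/-! ### Reduction decreases interpretations -/

theorem AC.interp_iff (h : AC s t) :
    ∀ {Γ : List (Ty ι)} {A : Ty ι} {f : Env ι → A.Den}, Interp Γ s A f ↔ Interp Γ t A f := by
  induction h with
  | comm =>
    intro Γ A f
    constructor <;> rintro (_ | _) <;> rename_i hf hg <;>
      exact (Interp.add hg hf).congr fun _ => comb_comm _ _ _
  | assoc =>
    intro Γ A f
    constructor
    · rintro (_ | _)
      rename_i hf hgh
      cases hgh with
      | add hg hh => exact (Interp.add (.add hf hg) hh).congr fun _ => (comb_assoc _ _ _ _).symm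
    · rintro (_ | _)
      rename_i hfg hh
      cases hfg with
      | add hf hg => exact (Interp.add hf (.add hg hh)).congr fun _ => comb_assoc _ _ _ _
  | refl => exact Iff.rfl
  | symm _ ih => exact ih.symm
  | trans _ _ ih₁ ih₂ => exact ih₁.trans ih₂
  | lam _ ih =>
    intro Γ A f
    constructor <;> rintro (_ | _) <;> rename_i hm hf
    exacts [.lam hm (ih.1 hf), .lam hm (ih.2 hf)]
  | appL _ ih =>
    intro Γ A f
    constructor <;> intro h <;> cases h with | app hf hg => ?_
    exacts [.app (ih.1 hf) hg, .app (ih.2 hf) hg]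
  | appR _ ih =>
    intro Γ A f
    constructor <;> intro h <;> cases h with | app hf hg => ?_
    exacts [.app hf (ih.1 hg), .app hf (ih.2 hg)]
  | pairL _ ih =>
    intro Γ A f
    constructor <;> rintro (_ | _) <;> rename_i hf hg
    exacts [.pair (ih.1 hf) hg, .pair (ih.2 hf) hg]
  | pairR _ ih =>
    intro Γ A f
    constructor <;> rintro (_ | _) <;> rename_i hf hg
    exacts [.pair hf (ih.1 hg), .pair hf (ih.2 hg)]
  | fst _ ih =>
    intro Γ A f
    constructor <;> rintro (_ | _) <;> rename_i hf
    exacts [.fst (ih.1 hf), .fst (ih.2 hf)]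
  | snd _ ih =>
    intro Γ A f
    constructor <;> rintro (_ | _) <;> rename_i hf
    exacts [.snd (ih.1 hf), .snd (ih.2 hf)]
  | addL _ ih =>
    intro Γ A f
    constructor <;> rintro (_ | _) <;> rename_i hf hg
    exacts [.add (ih.1 hf) hg, .add (ih.2 hf) hg]
  | addR _ ih =>
    intro Γ A f
    constructor <;> rintro (_ | _) <;> rename_i hf hg
    exacts [.add hf (ih.1 hg), .add hf (ih.2 hg)]
  | smul _ ih =>
    intro Γ A f
    constructor <;> rintro (_ | _) <;> rename_i hf hg
    exacts [.smul _ (ih.1 hf) (ih.1 hg), .smul _ (ih.2 hf) (ih.2 hg)]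
  | clos _ ih =>
    intro Γ A f
    constructor <;> rintro (_ | _) <;> rename_i hf
    exacts [.clos (ih.1 hf), .clos (ih.2 hf)]
  | unclos _ ih =>
    intro Γ A f
    constructor <;> rintro (_ | _) <;> rename_i hf
    exacts [.unclos (ih.1 hf), .unclos (ih.2 hf)]

/-- Every interpretation of `s` lies strictly above one of `t`. -/
def Decreases (ι : Type) (s t : Term K) : Prop :=
  ∀ ⦃Γ : List (Ty ι)⦄ ⦃A : Ty ι⦄ ⦃f : Env ι → A.Den⦄, Interp Γ s A f →
    ∃ g, Interp Γ t A g ∧ ∀ ρ, (g ρ).Below (f ρ)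

theorem Step.decreases {Rb : Term K → Term K → Prop} (hRb : ∀ s t, Rb s t → Decreases ι s t)
    (h : Step Rb s t) : Decreases ι s t := by
  induction h with
  | base h => exact hRb _ _ h
  | appL _ ih =>
    intro Γ A f h
    cases h with | app hf hg =>
    obtain ⟨_, hf, h⟩ := ih hf
    exact ⟨_, .app hf hg, fun ρ => (h ρ).app_left⟩
  | appR _ ih =>
    intro Γ A f h
    cases h with | app hf hg =>
    obtain ⟨_, hg, h⟩ := ih hg
    exact ⟨_, .app hf hg, fun ρ => (h ρ).app_right⟩
  | pairL _ ih =>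
    rintro Γ A _ (_ | _)
    rename_i hf hg
    obtain ⟨_, hf, h⟩ := ih hf
    exact ⟨_, .pair hf hg, fun ρ => (h ρ).pair_left⟩
  | pairR _ ih =>
    rintro Γ A _ (_ | _)
    rename_i hf hg
    obtain ⟨_, hg, h⟩ := ih hg
    exact ⟨_, .pair hf hg, fun ρ => (h ρ).pair_right⟩
  | fst _ ih =>
    rintro Γ A _ (_ | _)
    rename_i hf
    obtain ⟨_, hf, h⟩ := ih hf
    exact ⟨_, .fst hf, fun ρ => (h ρ).fst⟩
  | snd _ ih =>
    rintro Γ A _ (_ | _)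
    rename_i hf
    obtain ⟨_, hf, h⟩ := ih hf
    exact ⟨_, .snd hf, fun ρ => (h ρ).snd⟩
  | addL _ ih =>
    rintro Γ A _ (_ | _)
    rename_i hf hg
    obtain ⟨_, hf, h⟩ := ih hf
    exact ⟨_, .add hf hg, fun ρ => (h ρ).comb_left⟩
  | addR _ ih =>
    rintro Γ A _ (_ | _)
    rename_i hf hg
    obtain ⟨_, hg, h⟩ := ih hg
    exact ⟨_, .add hf hg, fun ρ => (h ρ).comb_right⟩
  | smul _ ih =>
    rintro Γ A _ (_ | _)
    rename_i hf hg
    obtain ⟨_, hf, h⟩ := ih hf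
    obtain ⟨_, hg, h'⟩ := ih hg
    exact ⟨_, .smul _ hf hg, fun ρ => (h ρ).comb (h' ρ)⟩
  | unclos _ ih =>
    rintro Γ A _ (_ | _)
    rename_i hf
    obtain ⟨_, hf, h⟩ := ih hf
    exact ⟨_, .unclos hf, fun ρ => (h ρ).unclos⟩
  | ac h₁ _ h₂ ih =>
    intro Γ A f hf
    obtain ⟨g, hg, h⟩ := ih (h₁.interp_iff.1 hf)
    exact ⟨g, h₂.interp_iff.1 hg, h⟩

theorem RuleB.decreases (h : RuleB s t) : Decreases ι s t := by
  intro Γ A f hf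
  cases h with
  | beta _ =>
    cases hf with | @app _ _ _ _ _ _ g hf hg =>
    cases hf with | @lam _ _ _ _ f hm hf =>
    exact ⟨_, hf.subst_zero hg, fun ρ => below_app_lam (fun x => f (Env.cons x ρ)) _ (g ρ)⟩
  | run =>
    cases hf with | unclos hf =>
    cases hf with | clos hf =>
    exact ⟨_, hf, fun ρ => below_unclos_clos _⟩
  | fst _ _ =>
    cases hf with | fst hf =>
    cases hf with | pair hf hg =>
    exact ⟨_, hf, fun ρ => below_fst_pair _ _⟩
  | snd _ _ =>
    cases hf with | snd hf =>
    cases hf with | pair hf hg =>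
    exact ⟨_, hg, fun ρ => below_snd_pair _ _⟩

theorem RuleA.decreases (h : RuleA s t) : Decreases ι s t := by
  intro Γ A f hf
  cases h with
  | add_app =>
    cases hf with | app hf hx =>
    cases hf with | add hf hg =>
    exact ⟨_, .add (.app hf hx) (.app hg hx), fun _ => comb_app_below two_pos _ _ _⟩
  | app_add =>
    cases hf with | app hf hx =>
    cases hx with | add hx hy =>
    exact ⟨_, .add (.app hf hx) (.app hf hy), fun _ => comb_app_below' two_pos _ _ _⟩
  | smul_app =>
    cases hf with | app hf hx =>
    cases hf with | smul _ hf hg =>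
    exact ⟨_, .smul _ (.app hf hx) (.app hg hx), fun _ => comb_app_below one_pos _ _ _⟩
  | app_smul =>
    cases hf with | app hf hx =>
    cases hx with | smul _ hx hy =>
    exact ⟨_, .smul _ (.app hf hx) (.app hf hy), fun _ => comb_app_below' one_pos _ _ _⟩
  | zero_app | app_zero =>
    cases hf with | app hf hx =>
    exact ⟨_, .zero, fun _ => zero_below (app_size_pos _ _)⟩
  | lam_add =>
    cases hf with | lam hm hf =>
    cases hf with | add hf hg =>
    exact ⟨_, .add (.lam hf.monotone hf) (.lam hg.monotone hg),
      fun _ => comb_lam_below two_pos _⟩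
  | lam_smul =>
    cases hf with | lam hm hf =>
    cases hf with | smul _ hf hg =>
    exact ⟨_, .smul _ (.lam hf.monotone hf) (.lam hg.monotone hg),
      fun _ => comb_lam_below one_pos _⟩
  | lam_zero =>
    cases hf with | lam hm hf =>
    exact ⟨_, .zero, fun _ => zero_below (Nat.succ_pos _)⟩
  | unclos_add =>
    cases hf with | unclos hf =>
    cases hf with | add hf hg =>
    exact ⟨_, .add (.unclos hf) (.unclos hg), fun _ => comb_unclos_below two_pos _ _⟩
  | unclos_smul =>
    cases hf with | unclos hf =>
    cases hf with | smul _ hf hg =>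
    exact ⟨_, .smul _ (.unclos hf) (.unclos hg), fun _ => comb_unclos_below one_pos _ _⟩
  | unclos_zero =>
    cases hf with | unclos hf =>
    exact ⟨_, .zero, fun _ => zero_below (by simp only [Sized.unclos]; lia)⟩

end Interpretation

theorem RuleE.decreases {s t : Term R} (h : RuleE s t) : Decreases ι s t := by
  intro Γ A f hf
  cases h with
  | smul_zero | zero_smul =>
    cases hf with | smul _ hf hg =>
    exact ⟨_, .zero, fun _ => zero_below (Nat.succ_pos _)⟩
  | one_smul =>
    cases hf with | smul _ hf hg =>
    exact ⟨_, hf, fun _ => below_comb_left one_pos _ _⟩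
  | zero_add =>
    cases hf with | add hf hg =>
    exact ⟨_, hg, fun _ => below_comb_right two_pos _ _⟩
  | smul_smul =>
    cases hf with | smul _ hf _ =>
    cases hf with | smul _ hf hg =>
    exact ⟨_, .smul _ hf hg, fun _ => below_comb_left one_pos _ _⟩
  | smul_add =>
    cases hf with | smul _ hf hg =>
    cases hf with | add hf hf' =>
    cases hg with | add hg hg' =>
    exact ⟨_, .add (.smul _ hf hg) (.smul _ hf' hg'), fun _ => comb_comb_below _ _ _ _⟩

theorem RuleF.decreases {s t : Term R} (h : RuleF s t) : Decreases ι s t := by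
  intro Γ A f hf
  cases h with
  | add_smul | smul_self =>
    cases hf with | add hf _ =>
    cases hf with | smul _ hf hg =>
    exact ⟨_, .smul _ hf hg, fun _ => below_comb_left two_pos _ _⟩
  | self_self =>
    cases hf with | add hf hg =>
    exact ⟨_, .smul _ hf hg, fun _ => comb_below_comb one_lt_two _ _⟩

theorem StepL.decreases {s t : Term R} (h : StepL s t) : Decreases ι s t :=
  Step.decreases (fun _ _ h => by
    rcases h with h | h | h | h
    exacts [h.decreases, h.decreases, h.decreases, h.decreases]) h

theorem Interp.length_le {Γ : List (Ty ι)} {A : Ty ι} (l : List (Term R)) {s : Term R}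
    {f : Env ι → A.Den} (hf : Interp Γ s A f) (hl : (s :: l).IsChain StepL) :
    l.length ≤ (f 0).1 := by
  induction l generalizing s f with
  | nil => exact Nat.zero_le _
  | cons t l ih =>
    rw [List.isChain_cons_cons] at hl
    obtain ⟨g, hg, h⟩ := hl.1.decreases hf
    exact (ih hg hl.2).trans_lt (h 0).1

/-- **Strong normalization** : every rewrite sequence (formalized as a list of
terms whose consecutive elements are related by `StepL`) starting from a closed
well-typed term `s` is finite, of length at most some bound `n_s`. -/
theorem strong_normalization {s : Term R} {A : Ty ι}
    (hs : Typed ([] : List (Ty ι)) s A) :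
    ∃ n : ℕ, ∀ l : List (Term R), l.head? = some s → l.Chain' StepL → l.length ≤ n := by
  obtain ⟨f, hf⟩ := hs.exists_interp
  refine ⟨(f 0).1 + 1, fun l hl hc => ?_⟩
  obtain ⟨l, rfl⟩ := List.head?_eq_some_iff.1 hl
  exact Nat.succ_le_succ (hf.length_le l hc)

end AlgLC
end

section
/- Self-increasing fixpoint in the untyped calculus: for every term b, setting V_b := λx.[¡(x x)+b] and Y_b := ¡(V_b V_b), one has Y_b →* Y_b + b. -/
/-!
Formalization of the computational algebraic lambda-calculus
(simply-typed, call-by-value lambda-calculus endowed with a structure of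
module over a ring `R` of scalars), using de Bruijn indices
(so that α-equivalence is definitional and substitution is capture-avoiding).
-/

namespace AlgLC

variable {R : Type} {ι : Type}

variable [Ring R]

/-- `V_b = λx.[¡(x x) + b]` (the free variables of `b` are lifted under the binder). -/
def Vb (b : Term R) : Term R :=
  .lam (.clos (.add (.unclos (.app (.var 0) (.var 0))) (lift 1 0 b)))

/-- `Y_b = ¡(V_b V_b)`. -/
def Yb (b : Term R) : Term R := .unclos (.app (Vb b) (Vb b))

theorem subst_lift_one {S : Type} (t : Term S) (k : ℕ) (v : Term S) : subst (lift 1 k t) k v = t := by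
  induction t generalizing k v with
  | var n => grind [lift, subst]
  | _ => simp_all [lift, subst]

theorem isValue_Vb {S : Type} (b : Term S) : IsValue (Vb b) := .lam .clos

/-- **Self-increasing fixpoint in the untyped calculus** : `Y_b →* Y_b + b`. -/
theorem Yb_self_increasing (b : Term R) :
    Relation.ReflTransGen StepL (Yb b) (.add (Yb b) b) := by
  have run : StepL (.unclos (.clos (.add (Yb b) b))) (.add (Yb b) b) :=
    .base (.inr (.inr (.inr (.run _))))
  refine .head (.unclos (.base (.inr (.inr (.inr (.beta (isValue_Vb b))))))) (.single ?_)
  simpa [subst, subst_lift_one, Yb] using run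

end AlgLC
end

section
/- Inconsistency of the naive untyped equational theory: let ≃ be the smallest call-by-value congruent equivalence relation on terms that is consistent with ≃_AC and contains the reduction L (i.e. s → t implies s ≃ t). Then every term b satisfies b ≃ 𝟎; in particular all terms are equated. -/
/-!
Formalization of the computational algebraic lambda-calculus
(simply-typed, call-by-value lambda-calculus endowed with a structure of
module over a ring `R` of scalars), using de Bruijn indices
(so that α-equivalence is definitional and substitution is capture-avoiding).
-/

namespace AlgLC

variable {R : Type} {ι : Type}

variable [Ring R]

/-- The smallest call-by-value congruent equivalence relation on terms,
consistent with `≃_AC`, containing the one-step reduction `L`. -/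
inductive EqL : Term R → Term R → Prop
  | step {s t} : StepL s t → EqL s t
  | refl (s) : EqL s s
  | symm {s t} : EqL s t → EqL t s
  | trans {s t u} : EqL s t → EqL t u → EqL s u
  | appL {s s' t} : EqL s s' → EqL (.app s t) (.app s' t)
  | appR {s t t'} : EqL t t' → EqL (.app s t) (.app s t')
  | pairL {s s' t} : EqL s s' → EqL (.pair s t) (.pair s' t)
  | pairR {s t t'} : EqL t t' → EqL (.pair s t) (.pair s t')
  | fst {s s'} : EqL s s' → EqL (.fst s) (.fst s')
  | snd {s s'} : EqL s s' → EqL (.snd s) (.snd s')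
  | addL {s s' t} : EqL s s' → EqL (.add s t) (.add s' t)
  | addR {s t t'} : EqL t t' → EqL (.add s t) (.add s t')
  | smul {a s s'} : EqL s s' → EqL (.smul a s) (.smul a s')
  | unclos {s s'} : EqL s s' → EqL (.unclos s) (.unclos s')
  | ac {s s' t t'} : AC s s' → EqL s' t' → AC t' t → EqL s t

theorem EqL.zero_add (s : Term R) : EqL (.add .zero s) s :=
  .step (.base (.inl (.zero_add s)))

theorem EqL.neg_add_self (s : Term R) : EqL (.add (.smul (-1) s) s) .zero := by
  have h : EqL (.add (.smul (-1) s) s) (.smul (-1 + 1) s) :=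
    .step (.base (.inr (.inl (.smul_self (-1) s))))
  rw [neg_add_cancel] at h
  exact h.trans (.step (.base (.inl (.zero_smul s))))

/-- The term `V_b = λx.[¡(x x) + b]`. -/
def fixBody (b : Term R) : Term R :=
  .lam (.clos (.add (.unclos (.app (.var 0) (.var 0))) (lift 1 0 b)))

/-- The term `Y_b = ¡(V_b V_b)`. -/
def fixTerm (b : Term R) : Term R :=
  .unclos (.app (fixBody b) (fixBody b))

theorem fixTerm_eq (b : Term R) : EqL (fixTerm b) (.add (fixTerm b) b) := by
  have hβ : EqL (.app (fixBody b) (fixBody b)) (.clos (.add (fixTerm b) b)) := by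
    have h : RuleB (.app (fixBody b) (fixBody b)) _ := .beta (.lam .clos)
    simp only [subst, subst_lift_one, if_true] at h
    exact .step (.base (.inr (.inr (.inr h))))
  exact (EqL.unclos hβ).trans (.step (.base (.inr (.inr (.inr (.run _))))))

/-- **Inconsistency of the naive untyped equational theory** : every term is
equated with `𝟎`. -/
theorem inconsistency (b : Term R) : EqL b .zero := by
  have hY := fixTerm_eq b
  exact (EqL.symm (.zero_add b)).trans <|
    (EqL.addL (EqL.symm (.neg_add_self (fixTerm b)))).trans <|
    (EqL.ac AC.assoc.symm (.refl _) (.refl _)).trans <|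
    (EqL.addR hY.symm).trans (.neg_add_self (fixTerm b))

end AlgLC
end

section
/- Type-preserving translation of Vaux's calculus λ_alg: if Δ ⊢ s : B is a valid typing judgment in the simply-typed λ_alg, then MΔ ⊢ ⟦s⟧ : ⟦B⟧ is a valid typing judgment in the computational algebraic lambda-calculus, where MΔ translates each declaration x:A of Δ to x:M⟦A⟧. -/
/-!
Formalization of the computational algebraic lambda-calculus
(simply-typed, call-by-value lambda-calculus endowed with a structure of
module over a ring `R` of scalars), using de Bruijn indices
(so that α-equivalence is definitional and substitution is capture-avoiding).
-/

namespace AlgLC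

variable {R : Type} {ι : Type}

variable [Ring R]

/-- Terms of the source simply-typed algebraic lambda-calculus. -/
inductive SrcTerm (R : Type) : Type
  | var : ℕ → SrcTerm R
  | lam : SrcTerm R → SrcTerm R
  | app : SrcTerm R → SrcTerm R → SrcTerm R
  | add : SrcTerm R → SrcTerm R → SrcTerm R
  | smul : R → SrcTerm R → SrcTerm R
  | zero : SrcTerm R

/-- Simple types of the source calculus: `A,B ::= ι | A → B`. -/
inductive SrcTy (ι : Type) : Type
  | base : ι → SrcTy ι
  | arrow : SrcTy ι → SrcTy ι → SrcTy ι

/-- Typing judgments of the source calculus. -/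
inductive SrcTyped : List (SrcTy ι) → SrcTerm R → SrcTy ι → Prop
  | var {Γ : List (SrcTy ι)} {n A} : Γ[n]? = some A → SrcTyped Γ (.var n) A
  | lam {Γ s A B} : SrcTyped (A :: Γ) s B → SrcTyped Γ (.lam s) (.arrow A B)
  | app {Γ s t A B} : SrcTyped Γ s (.arrow A B) → SrcTyped Γ t A → SrcTyped Γ (.app s t) B
  | zero {Γ A} : SrcTyped Γ .zero A
  | smul {Γ s A} (a : R) : SrcTyped Γ s A → SrcTyped Γ (.smul a s) A
  | add {Γ s t A} : SrcTyped Γ s A → SrcTyped Γ t A → SrcTyped Γ (.add s t) A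

/-- Translation of types: `⟦ι⟧ = ι`, `⟦A → B⟧ = M⟦A⟧ → ⟦B⟧`. -/
def trTyAlg : SrcTy ι → Ty ι
  | .base i => .base i
  | .arrow A B => .arrow (.m (trTyAlg A)) (trTyAlg B)

/-- Translation of the terms of Vaux's `λ_alg` : `⟦x⟧ = ¡x`, `⟦λx.s⟧ = λx.⟦s⟧`,
`⟦s t⟧ = ⟦s⟧ [⟦t⟧]`, homomorphically on the algebraic structure. -/
def trAlg : SrcTerm R → Term R
  | .var n => .unclos (.var n)
  | .lam s => .lam (trAlg s)
  | .app s t => .app (trAlg s) (.clos (trAlg t))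
  | .add s t => .add (trAlg s) (trAlg t)
  | .smul a s => .smul a (trAlg s)
  | .zero => .zero

/-- **Type-preserving translation of Vaux's calculus `λ_alg`** : if `Δ ⊢ s : B`
in `λ_alg` then `MΔ ⊢ ⟦s⟧ : ⟦B⟧`, where `MΔ` translates each declaration `x:A`
to `x:M⟦A⟧`. -/
theorem vaux_translation_typed {Γ : List (SrcTy ι)} {s : SrcTerm R} {B : SrcTy ι}
    (h : SrcTyped Γ s B) :
    Typed (Γ.map fun A => Ty.m (trTyAlg A)) (trAlg s) (trTyAlg B) := by
  induction h with
  | var h => exact .unclos (.var (by simp [h]))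
  | lam _ ih => exact .lam ih
  | app _ _ ihs iht => exact .app ihs (.clos iht)
  | zero => exact .zero
  | smul a _ ih => exact .smul a ih
  | add _ _ ihs iht => exact .add ihs iht

end AlgLC
end

section
/- Type-preserving translation of lineal (λ_lin): if Δ ⊢ s : B is a valid typing judgment in the simply-typed λ_lin, then ⟦Δ⟧ ⊢ ⟦s⟧ : ⟦B⟧ is a valid typing judgment in the computational algebraic lambda-calculus, where ⟦Δ⟧ translates each declaration x:A of Δ to x:⟦A⟧. -/
/-!
Formalization of the computational algebraic lambda-calculus
(simply-typed, call-by-value lambda-calculus endowed with a structure of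
module over a ring `R` of scalars), using de Bruijn indices
(so that α-equivalence is definitional and substitution is capture-avoiding).
-/

namespace AlgLC

variable {R : Type} {ι : Type}

variable [Ring R]

/-- Translation of types: `⟦ι⟧ = ι`, `⟦A → B⟧ = ⟦A⟧ → M⟦B⟧`. -/
def trTyLin : SrcTy ι → Ty ι
  | .base i => .base i
  | .arrow A B => .arrow (trTyLin A) (.m (trTyLin B))

/-- Translation of the terms of lineal (`λ_lin`) : `⟦x⟧ = x`,
`⟦λx.s⟧ = λx.[⟦s⟧]`, `⟦s t⟧ = ¡(⟦s⟧ ⟦t⟧)`, homomorphically on the algebraic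
structure. -/
def trLin : SrcTerm R → Term R
  | .var n => .var n
  | .lam s => .lam (.clos (trLin s))
  | .app s t => .unclos (.app (trLin s) (trLin t))
  | .add s t => .add (trLin s) (trLin t)
  | .smul a s => .smul a (trLin s)
  | .zero => .zero

/-- **Type-preserving translation of lineal (`λ_lin`)** : if `Δ ⊢ s : B` in
`λ_lin` then `⟦Δ⟧ ⊢ ⟦s⟧ : ⟦B⟧`, where `⟦Δ⟧` translates each declaration `x:A`
to `x:⟦A⟧`. -/
theorem lineal_translation_typed {Γ : List (SrcTy ι)} {s : SrcTerm R} {B : SrcTy ι}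
    (h : SrcTyped Γ s B) :
    Typed (Γ.map trTyLin) (trLin s) (trTyLin B) := by
  induction h with
  | var hn => exact .var (by simp [hn])
  | lam _ ih => exact .lam (.clos ih)
  | app _ _ ihs iht => exact .unclos (.app ihs iht)
  | zero => exact .zero
  | smul a _ ih => exact .smul a ih
  | add _ _ ihs iht => exact .add ihs iht

end AlgLC
end
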